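/- arXiv:math/0209058 — 2 statements merged into one kernel-verified Lean document; each statement's English description precedes it below -/
import Mathlib

section
/- Suppose 2 ≤ m < ∞ and let w be a nontrivial cyclically reduced word in the free group F(a,b) which represents the identity in the two-generator Artin group G = ⟨a, b | aba⋯ = bab⋯⟩ with m letters on each side of the relation. Then the syllable length of w satisfies ‖w‖ ≥ 2m. -/
/-- The alternating word `x y x y ⋯` with `m` letters, in the free group. -/
def altWord {σ : Type*} (x y : σ) : ℕ → FreeGroup σ
  | 0 => 1
  | m + 1 => FreeGroup.of x * altWord y x m

/-- The syllable length `‖w‖`: the number of maximal blocks of the form `a^n`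
in the reduced word representing `w`. -/
def syll {σ : Type*} [DecidableEq σ] (w : FreeGroup σ) : ℕ :=
  ((w.toWord.map Prod.fst).destutter (· ≠ ·)).length

/-- An element of a free group is cyclically reduced if, in its reduced word, the
first letter is not the inverse of the last letter (so all cyclic permutations
are also reduced). -/
def CyclicallyReduced {σ : Type*} [DecidableEq σ] (w : FreeGroup σ) : Prop :=
  ∀ x y, w.toWord.head? = some x → w.toWord.getLast? = some y → x ≠ (y.1, !y.2)

/-- The quotient map from `F(a,b)` onto the two-generator Artin group
`⟨a, b | aba⋯ = bab⋯⟩` with `m` letters on each side (`false ↦ a`, `true ↦ b`). -/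
def twoGenArtinMk (m : ℕ) :
    FreeGroup Bool →* PresentedGroup
      ({ altWord false true m * (altWord true false m)⁻¹ } : Set (FreeGroup Bool)) :=
  PresentedGroup.mk _

open Polynomial

/-- Fibonacci polynomials shifted: `E n = F (n-1)`. -/
noncomputable def artE : ℕ → ℤ[X]
  | 0 => 1
  | 1 => 0
  | n + 2 => X * artE (n + 1) + artE n

lemma artE_monic (n : ℕ) : (artE (n + 2)).Monic ∧ (artE (n + 2)).natDegree = n ∧
    (artE (n + 3)).Monic ∧ (artE (n + 3)).natDegree = n + 1 := by
  induction n with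
  | zero => simp [artE, monic_X]
  | succ n ih =>
    obtain ⟨h1, h2, h3, h4⟩ := ih
    have e : artE (n + 1 + 3) = X * artE (n + 3) + artE (n + 2) := by rw [artE]
    have hm : (X * artE (n + 3)).Monic := monic_X.mul h3
    have hd : (X * artE (n + 3)).natDegree = n + 2 := by
      rw [natDegree_X_mul h3.ne_zero, h4]
    have hlt : (artE (n + 2)).natDegree < (X * artE (n + 3)).natDegree := by omega
    refine ⟨h3, h4, ?_, ?_⟩
    · rw [e]
      exact hm.add_of_left (degree_lt_degree hlt)
    · rw [e, natDegree_add_eq_left_of_natDegree_lt hlt, hd]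

/-- Transvection as an element of SL. -/
def artT {R : Type*} [CommRing R] (x : Bool) (c : R) : Matrix.SpecialLinearGroup Bool R :=
  ⟨Matrix.transvection x (!x) c, Matrix.det_transvection_of_ne _ _ (by cases x <;> decide) _⟩

lemma artT_inv {R : Type*} [CommRing R] (x : Bool) (c : R) : (artT x c)⁻¹ = artT x (-c) := by
  apply inv_eq_of_mul_eq_one_right
  apply Subtype.ext
  change Matrix.transvection x (!x) c * Matrix.transvection x (!x) (-c) = 1
  rw [Matrix.transvection_mul_transvection_same _ _ (by cases x <;> decide)]
  simp

lemma artT_mul_same {R : Type*} [CommRing R] (x : Bool) (c : R)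
    (M : Matrix.SpecialLinearGroup Bool R) (j : Bool) :
    (artT x c * M).1 x j = M.1 x j + c * M.1 (!x) j := by
  change (Matrix.transvection x (!x) c * M.1) x j = _
  rw [Matrix.transvection_mul_apply_same]

lemma artT_mul_ne {R : Type*} [CommRing R] (x : Bool) (c : R)
    (M : Matrix.SpecialLinearGroup Bool R) (j : Bool) :
    (artT x c * M).1 (!x) j = M.1 (!x) j := by
  change (Matrix.transvection x (!x) c * M.1) (!x) j = _
  rw [Matrix.transvection_mul_apply_of_ne _ _ _ _ (by cases x <;> decide)]

/-- The representation over `ℤ[X]`. -/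
noncomputable def artRho : FreeGroup Bool →* Matrix.SpecialLinearGroup Bool ℤ[X] :=
  FreeGroup.lift (fun x => artT x X)

lemma artRho_alt (m : ℕ) : ∀ x : Bool,
    (artRho (altWord x (!x) m)).1 x (xor x (decide (m % 2 = 1))) = artE (m + 2) ∧
    (artRho (altWord x (!x) m)).1 x (!(xor x (decide (m % 2 = 1)))) = artE (m + 1) ∧
    (artRho (altWord x (!x) m)).1 (!x) (xor x (decide (m % 2 = 1))) = artE (m + 1) ∧
    (artRho (altWord x (!x) m)).1 (!x) (!(xor x (decide (m % 2 = 1)))) = artE m := by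
  induction m with
  | zero => intro x; cases x <;> simp [altWord, artE]
  | succ m ih =>
    intro x
    have e : artRho (altWord x (!x) (m + 1)) = artT x X * artRho (altWord (!x) x m) := by
      simp [altWord, artRho]
    have h := ih (!x)
    simp only [Bool.not_not] at h
    have hx : xor x (decide ((m + 1) % 2 = 1)) = xor (!x) (decide (m % 2 = 1)) := by
      rcases Nat.mod_two_eq_zero_or_one m with h | h
      · have : (m + 1) % 2 = 1 := by omega
        simp [h, this]
      · have : (m + 1) % 2 = 0 := by omega
        simp [h, this]
    obtain ⟨h1, h2, h3, h4⟩ := h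
    rw [hx, e, artT_mul_same, artT_mul_same, artT_mul_ne, artT_mul_ne, h1, h2, h3, h4]
    refine ⟨?_, ?_, rfl, rfl⟩
    · rw [artE.eq_3 (m + 1)]; ring
    · rw [artE.eq_3 m]; ring

lemma artRho_rel (m : ℕ) (i j : Bool) :
    X * artE (m + 1) ∣ (artRho (altWord false true m)).1 i j -
      (artRho (altWord true false m)).1 i j := by
  have h1 := artRho_alt m false
  have h2 := artRho_alt m true
  have e := artE.eq_3 m
  generalize decide (m % 2 = 1) = d at h1 h2
  simp only [Bool.not_false, Bool.not_true, Bool.false_xor, Bool.true_xor, Bool.not_not] at h1 h2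
  obtain ⟨a1, a2, a3, a4⟩ := h1
  obtain ⟨b1, b2, b3, b4⟩ := h2
  have hj : j = d ∨ j = !d := by cases j <;> cases d <;> decide
  rcases hj with rfl | rfl <;> cases i
  · rw [a1, b4, e]; exact ⟨1, by ring⟩
  · rw [a3, b2]; simp
  · rw [a2, b3]; simp
  · rw [a4, b1, e]; exact ⟨-1, by ring⟩

lemma artRho_dvd (m : ℕ) (w : FreeGroup Bool) (hrel : twoGenArtinMk m w = 1) (i j : Bool) :
    X * artE (m + 1) ∣ (artRho w).1 i j - (1 : Matrix Bool Bool ℤ[X]) i j := by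
  let I : Ideal ℤ[X] := Ideal.span {X * artE (m + 1)}
  let φ : FreeGroup Bool →* Matrix.SpecialLinearGroup Bool (ℤ[X] ⧸ I) :=
    (Matrix.SpecialLinearGroup.map (Ideal.Quotient.mk I)).comp artRho
  have hφ : φ (altWord false true m) = φ (altWord true false m) := by
    apply Subtype.ext
    ext i j
    change Ideal.Quotient.mk I ((artRho _).1 i j) = Ideal.Quotient.mk I ((artRho _).1 i j)
    rw [Ideal.Quotient.eq, Ideal.mem_span_singleton]
    exact artRho_rel m i j
  have hw : w ∈ φ.ker := by
    have h1 : w ∈ Subgroup.normalClosure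
        ({ altWord false true m * (altWord true false m)⁻¹ } : Set (FreeGroup Bool)) :=
      PresentedGroup.mk_eq_one_iff.1 hrel
    refine Subgroup.normalClosure_le_normal ?_ h1
    rintro _ rfl
    simp [hφ]
  have h2 : φ w = 1 := hw
  have h3 := congrFun (congrFun (congrArg Subtype.val h2) i) j
  rw [← Ideal.mem_span_singleton, ← Ideal.Quotient.eq]
  change Ideal.Quotient.mk I ((artRho w).1 i j) = _ at h3
  rw [h3]
  cases i <;> cases j <;> simp

lemma artRho_trace (m : ℕ) (w : FreeGroup Bool) (hrel : twoGenArtinMk m w = 1) :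
    (X * artE (m + 1)) ^ 2 ∣ (artRho w).1 false false + (artRho w).1 true true - 2 := by
  have hd : (artRho w).1 false false * (artRho w).1 true true
      - (artRho w).1 false true * (artRho w).1 true false = 1 := by
    have h := (artRho w).2
    rw [← Matrix.det_submatrix_equiv_self finTwoEquiv, Matrix.det_fin_two] at h
    simpa [finTwoEquiv] using h
  obtain ⟨a, ha⟩ := artRho_dvd m w hrel false false
  obtain ⟨b, hb⟩ := artRho_dvd m w hrel false true
  obtain ⟨c, hc⟩ := artRho_dvd m w hrel true false
  obtain ⟨d, hd'⟩ := artRho_dvd m w hrel true true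
  simp at ha hb hc hd'
  rw [sub_eq_iff_eq_add] at ha hd'
  refine ⟨b * c - a * d, ?_⟩
  rw [ha, hb, hc, hd'] at hd
  rw [ha, hd']
  linear_combination hd

/-- Invariant on the leading coefficients of the matrix of a reduced word. -/
structure ArtInv (e f : ℤ) (t : ℕ) (p q r s : ℤ[X]) : Prop where
  he : e = 1 ∨ e = -1
  hf : f = 1 ∨ f = -1
  d1 : ∀ k, t + 1 < k → p.coeff k = 0
  d2 : ∀ k, t < k → q.coeff k = 0
  d3 : ∀ k, t < k → r.coeff k = 0
  d4 : ∀ k, t < k + 1 → s.coeff k = 0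
  c1 : 0 < e * p.coeff (t + 1) * q.coeff t
  c2 : 0 < f * p.coeff (t + 1) * r.coeff t
  c3 : 0 ≤ f * q.coeff t * (X * s).coeff t

lemma artInv_base (e : ℤ) (he : e = 1 ∨ e = -1) : ArtInv e e 0 (C e * X) 1 1 0 where
  he := he
  hf := he
  d1 k hk := by rw [coeff_C_mul, coeff_X_of_ne_one (by omega), mul_zero]
  d2 k hk := by rw [coeff_one, if_neg (by omega)]
  d3 k hk := by rw [coeff_one, if_neg (by omega)]
  d4 k hk := by simp
  c1 := by rcases he with rfl | rfl <;> simp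
  c2 := by rcases he with rfl | rfl <;> simp
  c3 := by simp

lemma art_coeff (e : ℤ) (q : ℤ[X]) (k : ℕ) : (C e * X * q).coeff (k + 1) = e * q.coeff k := by
  rw [mul_assoc, coeff_C_mul, coeff_X_mul]

lemma art_sign {e f a b c d : ℤ} (he : e = 1 ∨ e = -1) (hf : f = 1 ∨ f = -1)
    (h1 : 0 < e * a * b) (h2 : 0 < f * a * c) (h3 : 0 ≤ f * b * d) :
    0 < e * (a + e * b) * b ∧ 0 < f * (a + e * b) * (c + e * d) := by
  have hb : b ≠ 0 := by rintro rfl; simp at h1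
  have ee : e * e = 1 := by rcases he with rfl | rfl <;> rfl
  have ff : f * f = 1 := by rcases hf with rfl | rfl <;> rfl
  have ha : a ≠ 0 := by rintro rfl; simp at h1
  have hb2 : 0 < b * b := mul_self_pos.2 hb
  have ha2 : 0 < a * a := mul_self_pos.2 ha
  constructor
  · have : e * (a + e * b) * b = e * a * b + (e * e) * (b * b) := by ring
    rw [this, ee]; linarith
  · have h4 : 0 ≤ (e * f * a * d) * (b * b) := by
      have := mul_nonneg h1.le h3
      nlinarith
    have h4' : 0 ≤ e * f * a * d := nonneg_of_mul_nonneg_left h4 hb2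
    have h5 : 0 < (e * f * b * c) * (a * a) := by
      have := mul_pos h1 h2
      nlinarith
    have h5' : 0 < e * f * b * c := by
      by_contra hn
      nlinarith [mul_nonneg (neg_nonneg.2 (not_lt.1 hn)) ha2.le]
    have : f * (a + e * b) * (c + e * d)
      = f * a * c + e * f * a * d + e * f * b * c + (e * e) * (f * b * d) := by ring
    rw [this, ee]; linarith

lemma artInv_same {e f : ℤ} {t : ℕ} {p q r s : ℤ[X]} (h : ArtInv e f t p q r s) :
    ArtInv e f t (p + C e * X * q) q (r + C e * X * s) s := by
  have hs : (C e * X * s).coeff t = e * (X * s).coeff t := by rw [mul_assoc, coeff_C_mul]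
  have key := art_sign h.he h.hf h.c1 h.c2 h.c3
  refine ⟨h.he, h.hf, ?_, h.d2, ?_, h.d4, ?_, ?_, h.c3⟩
  · intro k hk
    obtain ⟨k, rfl⟩ : ∃ j, k = j + 1 := ⟨k - 1, by omega⟩
    rw [coeff_add, art_coeff, h.d1 _ hk, h.d2 _ (by omega)]; simp
  · intro k hk
    obtain ⟨k, rfl⟩ : ∃ j, k = j + 1 := ⟨k - 1, by omega⟩
    rw [coeff_add, art_coeff, h.d3 _ hk, h.d4 _ (by omega)]; simp
  · rw [coeff_add, art_coeff]; exact key.1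
  · rw [coeff_add, coeff_add, art_coeff, hs]; exact key.2

lemma artInv_diff {e e' f : ℤ} {t : ℕ} {p q r s : ℤ[X]} (h : ArtInv e f t p q r s)
    (he' : e' = 1 ∨ e' = -1) :
    ArtInv e' f (t + 1) (q + C e' * X * p) p (s + C e' * X * r) r := by
  have ee : e' * e' = 1 := by rcases he' with rfl | rfl <;> rfl
  have hp : p.coeff (t + 1) ≠ 0 := by intro h0; have := h.c1; simp [h0] at this
  refine ⟨he', h.hf, ?_, h.d1, ?_, ?_, ?_, ?_, ?_⟩
  · intro k hk
    obtain ⟨k, rfl⟩ : ∃ j, k = j + 1 := ⟨k - 1, by omega⟩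
    rw [coeff_add, art_coeff, h.d1 _ (by omega), h.d2 _ (by omega)]; simp
  · intro k hk
    obtain ⟨k, rfl⟩ : ∃ j, k = j + 1 := ⟨k - 1, by omega⟩
    rw [coeff_add, art_coeff, h.d3 _ (by omega), h.d4 _ (by omega)]; simp
  · intro k hk
    exact h.d3 _ (by omega)
  · rw [coeff_add, art_coeff, h.d2 _ (by omega)]
    have := mul_self_pos.2 hp
    have e2 : e' * (0 + e' * p.coeff (t + 1)) * p.coeff (t + 1)
      = (e' * e') * (p.coeff (t + 1) * p.coeff (t + 1)) := by ring
    rw [e2, ee]; linarith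
  · rw [coeff_add, coeff_add, art_coeff, art_coeff, h.d2 _ (by omega), h.d4 _ (by omega)]
    have e2 : f * (0 + e' * p.coeff (t + 1)) * (0 + e' * r.coeff t)
      = (e' * e') * (f * p.coeff (t + 1) * r.coeff t) := by ring
    rw [e2, ee]; linarith [h.c2]
  · rw [coeff_X_mul]; exact h.c2.le

/-- Sign of a letter. -/
def artSg (b : Bool) : ℤ := cond b 1 (-1)

lemma artSg_or (b : Bool) : artSg b = 1 ∨ artSg b = -1 := by cases b <;> simp [artSg]

lemma artRho_cons (x b : Bool) (L : List (Bool × Bool)) :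
    artRho (FreeGroup.mk ((x, b) :: L)) = artT x (C (artSg b) * X) * artRho (FreeGroup.mk L) := by
  rw [artRho, FreeGroup.lift_mk, FreeGroup.lift_mk, List.map_cons, List.prod_cons]
  cases b <;> simp [artSg, artT_inv]

lemma artInv_word (y f : Bool) : ∀ (L : List (Bool × Bool)) (x e : Bool),
    FreeGroup.IsReduced ((x, e) :: L) → ((x, e) :: L).getLast? = some (y, f) →
    ∃ t, ((((x, e) :: L).map Prod.fst).destutter (· ≠ ·)).length = t + 1 ∧
      ArtInv (artSg e) (artSg f) t
        ((artRho (FreeGroup.mk ((x, e) :: L))).1 x (!y))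
        ((artRho (FreeGroup.mk ((x, e) :: L))).1 (!x) (!y))
        ((artRho (FreeGroup.mk ((x, e) :: L))).1 x y)
        ((artRho (FreeGroup.mk ((x, e) :: L))).1 (!x) y) := by
  intro L
  induction L with
  | nil =>
    intro x e _ hl
    simp only [List.getLast?_singleton, Option.some.injEq, Prod.mk.injEq] at hl
    obtain ⟨rfl, rfl⟩ := hl
    refine ⟨0, by simp, ?_⟩
    rw [artRho_cons, artT_mul_same, artT_mul_same, artT_mul_ne, artT_mul_ne]
    have h1 : artRho (FreeGroup.mk []) = 1 := by
      rw [← FreeGroup.one_eq_mk, map_one]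
    rw [h1]
    convert artInv_base (artSg e) (artSg_or e) using 1 <;> cases x <;> simp
  | cons z L ih =>
    obtain ⟨x', e'⟩ := z
    intro x e hr hl
    rw [FreeGroup.isReduced_cons_cons] at hr
    rw [List.getLast?_cons_cons] at hl
    obtain ⟨t, ht, hI⟩ := ih x' e' hr.2 hl
    rw [artRho_cons, artT_mul_same, artT_mul_same, artT_mul_ne, artT_mul_ne]
    rw [List.map_cons] at ht
    rw [List.map_cons, List.map_cons, List.destutter_cons_cons]
    by_cases hx : x = x'
    · subst hx
      have he : e = e' := hr.1 rfl
      subst he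
      refine ⟨t, ?_, artInv_same hI⟩
      rw [List.destutter_cons'] at ht
      simpa using ht
    · have hx' : x' = !x := by cases x <;> cases x' <;> simp_all
      subst hx'
      refine ⟨t + 1, ?_, ?_⟩
      · rw [List.destutter_cons'] at ht
        simp only [ne_eq, hx, not_false_eq_true, if_true, List.length_cons]
        rw [← ht]
      · simp only [Bool.not_not] at hI ⊢
        exact artInv_diff hI (artSg_or e)

/-- (Appel–Schupp) If `2 ≤ m < ∞` and `w` is a nontrivial cyclically reduced word in
`F(a,b)` representing the identity of the two-generator Artin group with label `m`,
then `‖w‖ ≥ 2m`. -/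
theorem syll_ge_of_artin_relator (m : ℕ) (hm : 2 ≤ m) (w : FreeGroup Bool)
    (hw : w ≠ 1) (hcyc : CyclicallyReduced w) (hrel : twoGenArtinMk m w = 1) :
    2 * m ≤ syll w := by
  obtain ⟨k, rfl⟩ : ∃ k, m = k + 1 := ⟨m - 1, by omega⟩
  obtain ⟨hmon, hdeg, -, -⟩ := artE_monic k
  have hDdeg : (X * artE (k + 1 + 1)).natDegree = k + 1 := by
    rw [natDegree_X_mul hmon.ne_zero, hdeg]
  have htr := artRho_trace (k + 1) w hrel
  have hdv := artRho_dvd (k + 1) w hrel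
  have hD2 : ((X * artE (k + 1 + 1)) ^ 2).natDegree = 2 * (k + 1) := by
    rw [natDegree_pow, hDdeg]
  have hred : FreeGroup.IsReduced w.toWord := FreeGroup.isReduced_toWord
  have hne : w.toWord ≠ [] := by simpa using hw
  obtain ⟨⟨x, e⟩, L, hL⟩ := List.exists_cons_of_ne_nil hne
  obtain ⟨⟨y, f⟩, hl⟩ : ∃ z, w.toWord.getLast? = some z :=
    ⟨_, List.getLast?_eq_some_getLast hne⟩
  have hc := hcyc (x, e) (y, f) (by rw [hL]; rfl) hl
  rw [hL] at hred hl
  obtain ⟨t, ht, hI⟩ := artInv_word y f L x e hred hl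
  have hmk : FreeGroup.mk ((x, e) :: L) = w := by rw [← hL, FreeGroup.mk_toWord]
  rw [hmk] at hI
  have hs : syll w = t + 1 := by rw [syll, hL, ht]
  rw [hs]
  have htx : (X * artE (k + 1 + 1)) ^ 2 ∣ (artRho w).1 x x + (artRho w).1 (!x) (!x) - 2 := by
    cases x
    · exact htr
    · rw [add_comm ((artRho w).1 true true)]; exact htr
  -- general degree argument
  have gen : ∀ n, 1 ≤ n → (∀ j, n < j → ((artRho w).1 x x + (artRho w).1 (!x) (!x)).coeff j = 0) →
      ((artRho w).1 x x + (artRho w).1 (!x) (!x)).coeff n ≠ 0 → 2 * (k + 1) ≤ n := by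
    intro n hn h0 h1
    have h2 : ∀ j, 1 ≤ j → (2 : ℤ[X]).coeff j = 0 := by
      intro j hj
      have : (2 : ℤ[X]) = C 2 := rfl
      rw [this, coeff_C, if_neg (by omega)]
    have hnz : (artRho w).1 x x + (artRho w).1 (!x) (!x) - 2 ≠ 0 := by
      intro h
      apply h1
      have := congrArg (fun p => coeff p n) h
      simpa [h2 n hn] using this
    have hle := natDegree_le_of_dvd htx hnz
    rw [hD2] at hle
    refine hle.trans (natDegree_le_iff_coeff_eq_zero.2 ?_)
    intro j hj
    rw [coeff_sub, h0 j hj, h2 j (by omega), sub_zero]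
  by_cases hxy : y = x
  · subst hxy
    have hef : e = f := by
      by_contra h
      apply hc
      cases e <;> cases f <;> simp_all
    subst hef
    rcases Nat.eq_zero_or_pos t with rfl | htp
    · exfalso
      have h1 := hdv y (!y)
      rw [Matrix.one_apply_ne (by cases y <;> decide), sub_zero] at h1
      have hp : ((artRho w).1 y (!y)).coeff 1 ≠ 0 := by
        intro h0; have := hI.c1; simp [h0] at this
      have hnz : (artRho w).1 y (!y) ≠ 0 := by
        intro h; rw [h] at hp; simp at hp
      have h2 := natDegree_le_of_dvd h1 hnz
      have h3 : ((artRho w).1 y (!y)).natDegree ≤ 1 :=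
        natDegree_le_iff_coeff_eq_zero.2 (fun j hj => hI.d1 j hj)
      omega
    · have := gen t htp ?_ ?_
      · omega
      · intro j hj
        rw [coeff_add, hI.d2 j hj, hI.d3 j hj, add_zero]
      · rw [coeff_add]
        intro h
        have h1 := hI.c1
        have h2 := hI.c2
        have h3 : ((artRho w).1 y y).coeff t = - ((artRho w).1 (!y) (!y)).coeff t := by linarith
        rw [h3] at h2
        nlinarith
  · have hx' : y = !x := by cases x <;> cases y <;> simp_all
    subst hx'
    simp only [Bool.not_not] at hI
    apply gen (t + 1) (by omega)
    · intro j hj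
      rw [coeff_add, hI.d1 j hj, hI.d4 j (by omega), add_zero]
    · rw [coeff_add, hI.d4 (t + 1) (by omega), add_zero]
      intro h0; have := hI.c1; simp [h0] at this
end

section
/- Let G be an Artin group on generators a₁,…,aₙ with all labels m_{ij} ≥ 4. If i, j, k are indices with j ≠ k and both m_{ij} and m_{ik} finite, then the intersection of the parabolic subgroups G_{ij} = ⟨a_i, a_j⟩ and G_{ik} = ⟨a_i, a_k⟩ in G equals the cyclic subgroup ⟨a_i⟩. -/
/-- The defining relators `u_{ij} u_{ji}⁻¹` of the Artin group with Coxeter-type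
labels `M : Fin n → Fin n → ℕ∞` (relations with `M i j = ∞` are omitted). -/
def artinRels (n : ℕ) (M : Fin n → Fin n → ℕ∞) : Set (FreeGroup (Fin n)) :=
  { r | ∃ i j : Fin n, i ≠ j ∧ ∃ m : ℕ, M i j = (m : ℕ∞) ∧
      r = altWord i j m * (altWord j i m)⁻¹ }

/-- The quotient map from the free group onto the Artin group with labels `M`. -/
def artinMk (n : ℕ) (M : Fin n → Fin n → ℕ∞) :
    FreeGroup (Fin n) →* PresentedGroup (artinRels n M) :=
  PresentedGroup.mk _

namespace ArtinAux

section Abstract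
variable {B W : Type*} [Group W] (s : B → W)

/-- Product of a word. -/
def pw (ω : List B) : W := (ω.map s).prod

@[simp] lemma pw_nil : pw s [] = 1 := rfl
@[simp] lemma pw_cons (b : B) (ω : List B) : pw s (b :: ω) = s b * pw s ω := by simp [pw]
@[simp] lemma pw_append (ω ω' : List B) : pw s (ω ++ ω') = pw s ω * pw s ω' := by simp [pw]

/-- Right inversion sequence. -/
def ris : List B → List W
  | [] => []
  | b :: ω => ((pw s ω)⁻¹ * s b * pw s ω) :: ris ω

/-- Left inversion sequence. -/
def lis : List B → List W
  | [] => []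
  | b :: ω => s b :: (lis ω).map (fun r => s b * r * s b)

@[simp] lemma ris_length (ω : List B) : (ris s ω).length = ω.length := by
  induction ω with
  | nil => rfl
  | cons b ω ih => simp [ris, ih]

/-- Alternating list. -/
def altL (x y : B) : ℕ → List B
  | 0 => []
  | k + 1 => x :: altL y x k

variable {s} (hs : ∀ b, s b * s b = 1)
include hs

lemma ris_eq_map_lis (ω : List B) :
    ris s ω = (lis s ω).map (fun r => (pw s ω)⁻¹ * r * pw s ω) := by
  induction ω with
  | nil => rfl
  | cons b ω ih =>
    have h1 : (s b)⁻¹ = s b := by rw [inv_eq_iff_mul_eq_one]; exact hs b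
    simp only [ris, lis, List.map_cons, ih, List.map_map, pw_cons, mul_inv_rev, h1]
    congr 1
    · simp only [mul_assoc]; rw [← mul_assoc (s b) (s b), hs]; simp
    · apply List.map_congr_left
      intro r _
      have h2 : ∀ x, s b * (s b * x) = x := fun x => by rw [← mul_assoc, hs, one_mul]
      simp [mul_assoc, h2]

lemma lis_altL (x y : B) (k : ℕ) :
    lis s (altL x y k) = (List.range k).map (fun q => (s x * s y) ^ q * s x) := by
  induction k generalizing x y with
  | zero => rfl
  | succ k ih =>
    rw [altL, lis, ih, List.range_succ_eq_map]
    simp only [List.map_cons, pow_zero, one_mul, List.map_map]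
    congr 1
    apply List.map_congr_left
    intro q hq
    have : s x * (s y * s x) ^ q = (s x * s y) ^ q * s x := by
      clear ih hq
      induction q with
      | zero => simp
      | succ q ih => rw [pow_succ, ← mul_assoc, ih, pow_succ]; simp [mul_assoc]
    simp only [Function.comp]
    rw [← mul_assoc, this, pow_succ]; simp [mul_assoc]

lemma ris_altL_nodup (x y : B) (m : ℕ) (h : ∀ k, (s x * s y) ^ k = 1 → m ∣ k) :
    (ris s (altL x y m)).Nodup := by
  rw [ris_eq_map_lis hs, lis_altL hs, List.map_map]
  have key : ∀ p q : ℕ, p ≤ q → q < m → (s x * s y) ^ p = (s x * s y) ^ q → p = q := by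
    intro p q hpq hq he
    have : (s x * s y) ^ (q - p) = 1 := by
      rw [pow_sub _ hpq, he]; simp
    have := h _ this
    have := Nat.eq_zero_of_dvd_of_lt this (by omega)
    omega
  refine (List.nodup_map_iff_inj_on List.nodup_range).2 ?_
  intro p hp q hq he
  simp only [List.mem_range] at hp hq
  simp only [Function.comp, mul_left_inj, mul_right_inj] at he
  rcases le_total p q with h' | h'
  · exact key p q h' hq he
  · exact (key q p h' hp he.symm).symm

lemma pw_altL_quot (x y : B) (k : ℕ) :
    pw s (altL x y k) * (pw s (altL y x k))⁻¹ = (s x * s y) ^ k := by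
  induction k generalizing x y with
  | zero => simp [altL]
  | succ k ih =>
    have h1 : (s y)⁻¹ = s y := by rw [inv_eq_iff_mul_eq_one]; exact hs y
    simp only [altL, pw_cons, mul_inv_rev, h1]
    have := ih y x
    calc _ = s x * (pw s (altL y x k) * (pw s (altL x y k))⁻¹) * s y := by simp [mul_assoc]
      _ = s x * (s y * s x) ^ k * s y := by rw [this]
      _ = _ := by
        have : s x * (s y * s x) ^ k = (s x * s y) ^ k * s x := by
          clear ih this
          induction k with
          | zero => simp
          | succ q ih => rw [pow_succ, ← mul_assoc, ih, pow_succ]; simp [mul_assoc]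
        rw [this, pow_succ]; simp [mul_assoc]

lemma pw_altL_eq_iff (x y : B) (k : ℕ) :
    pw s (altL x y k) = pw s (altL y x k) ↔ (s x * s y) ^ k = 1 := by
  rw [← pw_altL_quot hs, mul_inv_eq_one]

lemma exists_del (ω : List B) (r : W) (hr : r ∈ ris s ω) :
    ∃ ω', ω'.Sublist ω ∧ ω'.length < ω.length ∧ pw s ω' = pw s ω * r := by
  induction ω with
  | nil => simp [ris] at hr
  | cons b ω ih =>
    simp only [ris, List.mem_cons] at hr
    rcases hr with rfl | hr
    · refine ⟨ω, by simp, by simp, ?_⟩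
      have h2 : ∀ x, s b * (s b * x) = x := fun x => by rw [← mul_assoc, hs, one_mul]
      simp [mul_assoc, h2]
    · obtain ⟨ω', h1, h2, h3⟩ := ih hr
      exact ⟨b :: ω', by simpa using h1, by simpa using h2, by simp [h3, mul_assoc]⟩

lemma exists_short (ω : List B) (h : ¬ (ris s ω).Nodup) :
    ∃ ω', ω'.Sublist ω ∧ ω'.length < ω.length ∧ pw s ω' = pw s ω := by
  induction ω with
  | nil => simp [ris] at h
  | cons b ω ih =>
    simp only [ris, List.nodup_cons, not_and_or, not_not] at h
    rcases h with h | h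
    · obtain ⟨ω', h1, h2, h3⟩ := exists_del hs ω _ h
      exact ⟨ω', h1.trans (by simp), by simp; omega, by rw [h3]; simp [mul_assoc]⟩
    · obtain ⟨ω', h1, h2, h3⟩ := ih h
      exact ⟨b :: ω', by simpa using h1, by simpa using h2, by simp [h3]⟩

lemma exists_nodup (ω : List B) :
    ∃ ω', ω'.Sublist ω ∧ (ris s ω').Nodup ∧ pw s ω' = pw s ω := by
  induction hn : ω.length using Nat.strong_induction_on generalizing ω with
  | _ k ih =>
    by_cases h : (ris s ω).Nodup
    · exact ⟨ω, by simp, h, rfl⟩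
    · obtain ⟨ω', h1, h2, h3⟩ := exists_short hs ω h
      obtain ⟨ω'', g1, g2, g3⟩ := ih _ (hn ▸ h2) ω' rfl
      exact ⟨ω'', g1.trans h1, g2, g3.trans h3⟩

omit hs
variable (s) in
/-- Parabolic membership. -/
def In (X : Set B) (w : W) : Prop := ∃ ω : List B, (∀ b ∈ ω, b ∈ X) ∧ pw s ω = w

lemma In.one (X : Set B) : In s X 1 := ⟨[], by simp, rfl⟩
lemma In.gen {X : Set B} {b : B} (h : b ∈ X) : In s X (s b) := ⟨[b], by simpa, by simp⟩
lemma In.mul {X : Set B} {u v : W} (hu : In s X u) (hv : In s X v) : In s X (u * v) := by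
  obtain ⟨a, ha, rfl⟩ := hu
  obtain ⟨b, hb, rfl⟩ := hv
  refine ⟨a ++ b, ?_, by simp⟩
  intro x hx
  rcases List.mem_append.1 hx with h | h
  exacts [ha x h, hb x h]
include hs in
lemma In.inv {X : Set B} {u : W} (hu : In s X u) : In s X u⁻¹ := by
  obtain ⟨a, ha, rfl⟩ := hu
  induction a with
  | nil => simpa using In.one X
  | cons b a ih =>
    have h1 : (s b)⁻¹ = s b := by rw [inv_eq_iff_mul_eq_one]; exact hs b
    simp only [pw_cons, mul_inv_rev, h1]
    exact (ih (fun x hx => ha x (by simp [hx]))).mul (In.gen (ha b (by simp)))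

include hs in
lemma In_of_mem_ris {X : Set B} {ω : List B} (h : ∀ b ∈ ω, b ∈ X) {r : W} (hr : r ∈ ris s ω) :
    In s X r := by
  obtain ⟨ω', h1, h2, h3⟩ := exists_del hs ω r hr
  have : r = (pw s ω)⁻¹ * pw s ω' := by rw [h3]; simp
  rw [this]
  exact (In.inv hs ⟨ω, h, rfl⟩).mul ⟨ω', fun b hb => h b (h1.subset hb), rfl⟩

open scoped Classical in
/-- The inversion cocycle hypothesis. -/
structure IsCocycle (s : B → W) (N : W → W → ZMod 2) : Prop where
  mul : ∀ u v r, N (u * v) r = N v r + N u (v * r * v⁻¹)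
  gen : ∀ b r, N (s b) r = if r = s b then 1 else 0

variable {N : W → W → ZMod 2} (hN : IsCocycle s N)
include hN

lemma N_one (r : W) : N 1 r = 0 := by
  have := hN.mul 1 1 r
  simpa using this

open scoped Classical in
lemma N_pw (ω : List B) (r : W) : N (pw s ω) r = ((ris s ω).count r : ZMod 2) := by
  induction ω with
  | nil => simp [ris, N_one hN]
  | cons b ω ih =>
    rw [pw_cons, hN.mul, ih, hN.gen, ris, List.count_cons]
    have : (pw s ω * r * (pw s ω)⁻¹ = s b) ↔ ((pw s ω)⁻¹ * s b * pw s ω = r) := by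
      constructor
      · intro h; rw [← h]; group
      · intro h; rw [← h]; group
    by_cases h : (pw s ω)⁻¹ * s b * pw s ω = r
    · rw [if_pos (this.2 h)]; simp [h]
    · rw [if_neg (fun h' => h (this.1 h'))]; simp [h]

lemma mem_ris_of_N {ω : List B} {r : W} (h : N (pw s ω) r ≠ 0) : r ∈ ris s ω := by
  classical
  rw [N_pw hN] at h
  by_contra h'
  exact h (by rw [List.count_eq_zero.2 h']; simp)

lemma mem_ris_iff {ω : List B} (hn : (ris s ω).Nodup) {r : W} :
    r ∈ ris s ω ↔ N (pw s ω) r = 1 := by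
  classical
  constructor
  · intro h
    rw [N_pw hN, List.count_eq_one_of_mem hn h]; simp
  · intro h
    apply mem_ris_of_N hN
    rw [h]; decide

include hs

lemma N_out {X : Set B} {w r : W} (hw : In s X w) (hr : ¬ In s X r) : N w r = 0 := by
  obtain ⟨ω, h, rfl⟩ := hw
  by_contra h'
  exact hr (In_of_mem_ris hs h (mem_ris_of_N hN h'))

lemma eq_one_of_N {X : Set B} {w : W} (hw : In s X w) (h : ∀ r, N w r = 0) : w = 1 := by
  obtain ⟨ω, h1, rfl⟩ := hw
  obtain ⟨ω', g1, g2, g3⟩ := exists_nodup hs ω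
  rw [← g3] at h ⊢
  cases ω' with
  | nil => rfl
  | cons b ω' =>
    exfalso
    have := (mem_ris_iff hN g2 (r := (pw s ω')⁻¹ * s b * pw s ω')).1 (by simp [ris])
    rw [h] at this
    exact absurd this (by decide)

lemma simple_of_N {X : Set B} {t : W} (ht : In s X t) (h : ∀ r, N t r = 1 ↔ r = t) :
    ∃ b ∈ X, t = s b := by
  obtain ⟨ω, h1, rfl⟩ := ht
  obtain ⟨ω', g1, g2, g3⟩ := exists_nodup hs ω
  have hmem : ∀ b ∈ ω', b ∈ X := fun b hb => h1 b (g1.subset hb)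
  rw [← g3] at h ⊢
  have h2 : ∀ r ∈ ris s ω', r = pw s ω' := fun r hr => (h r).1 ((mem_ris_iff hN g2).1 hr)
  match ω', g2, h, h2, hmem with
  | [], g2, h, h2, _ =>
    have := (h 1).2 (by simp)
    rw [pw_nil, N_one hN] at this
    exact absurd this (by decide)
  | [b], _, _, _, hmem => exact ⟨b, hmem b (by simp), by simp⟩
  | b :: c :: ω'', g2, _, h2, _ =>
    exfalso
    simp only [ris] at g2 h2
    have e1 := h2 _ (List.mem_cons_self)
    have e2 := h2 _ (List.mem_cons_of_mem _ (List.mem_cons_self))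
    rw [e1, e2] at g2
    simp at g2

lemma decomp (X Y : Set B) {u : W} (hu : In s Y u) :
    ∃ v, In s X v ∧ In s Y v ∧ ∀ r, In s X r → N (u * v⁻¹) r = 0 := by
  obtain ⟨ω, h, rfl⟩ := hu
  induction hn : ω.length using Nat.strong_induction_on generalizing ω with
  | _ k ih =>
    by_cases hc : ∀ r, In s X r → N (pw s ω) r = 0
    · exact ⟨1, In.one _, In.one _, by simpa using hc⟩
    · push Not at hc
      obtain ⟨r, hr, hr'⟩ := hc
      have hm := mem_ris_of_N hN hr'
      obtain ⟨ω', h1, h2, h3⟩ := exists_del hs ω r hm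
      obtain ⟨v, a1, a2, a3⟩ := ih _ (hn ▸ h2) ω' (fun b hb => h b (h1.subset hb)) rfl
      have hrY := In_of_mem_ris hs h hm
      refine ⟨v * r⁻¹, a1.mul (hr.inv hs), a2.mul (hrY.inv hs), ?_⟩
      intro q hq
      have := a3 q hq
      rw [h3] at this
      simpa [mul_assoc] using this

lemma decomp_unique {X : Set B} {u v v' : W} (hv : In s X v) (hv' : In s X v')
    (h : ∀ r, In s X r → N (u * v⁻¹) r = 0) (h' : ∀ r, In s X r → N (u * v'⁻¹) r = 0) :
    v = v' := by
  have hx : In s X (v * v'⁻¹) := hv.mul (hv'.inv hs)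
  have : v * v'⁻¹ = 1 := by
    apply eq_one_of_N hs hN hx
    intro r
    by_cases hr : In s X r
    · have e : u * v'⁻¹ = (u * v⁻¹) * (v * v'⁻¹) := by group
      have h1 := h' r hr
      rw [e, hN.mul, h _ ((hx.mul hr).mul (hx.inv hs)), add_zero] at h1
      exact h1
    · exact N_out hs hN hx hr
  exact mul_inv_eq_one.1 this

end Abstract
end ArtinAux
namespace ArtinAux
section Geom
variable {n : ℕ} 

/-- Reflection. -/
noncomputable def rfn (c : Fin n → Fin n → ℂ) (b : Fin n) : Module.End ℂ (Fin n → ℂ) where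
  toFun z := z - (∑ x, c b x * z x) • Pi.single b 1
  map_add' z z' := by
    simp only [Pi.add_apply, mul_add, Finset.sum_add_distrib, add_smul]; abel
  map_smul' a z := by
    simp only [Pi.smul_apply, smul_eq_mul, RingHom.id_apply, smul_sub, smul_smul, Finset.mul_sum]
    congr 2
    apply Finset.sum_congr rfl; intros; ring

lemma rfn_apply (c : Fin n → Fin n → ℂ) (b : Fin n) (z) :
    rfn c b z = z - (∑ x, c b x * z x) • Pi.single b 1 := rfl

lemma rfn_single (c : Fin n → Fin n → ℂ) (a b : Fin n) :
    rfn c b (Pi.single a 1) = Pi.single a 1 - c b a • Pi.single b 1 := by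
  rw [rfn_apply]; simp [Pi.single_apply]

lemma rfn_eig (c : Fin n → Fin n → ℂ) (a b : Fin n) (q : ℂ) (hq : q ≠ 0)
    (ha : c a a = 2) (hb : c b b = 2) (hab : c a b = -(q + q⁻¹)) (hba : c b a = -(q + q⁻¹)) :
    (rfn c a * rfn c b) (q • Pi.single a 1 + Pi.single b 1) =
      (q ^ 2) • (q • Pi.single a 1 + Pi.single b 1) := by
  simp only [Module.End.mul_apply, map_add, map_smul, map_sub, rfn_single, ha, hb, hab, hba]
  simp only [smul_sub, smul_add, smul_smul]
  ext x
  simp only [Pi.add_apply, Pi.sub_apply, Pi.smul_apply, smul_eq_mul]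
  field_simp
  ring

lemma rfn_pow_eig (T : Module.End ℂ (Fin n → ℂ)) (v : Fin n → ℂ) (l : ℂ) (h : T v = l • v) (k : ℕ) :
    (T ^ k) v = l ^ k • v := by
  induction k with
  | zero => simp
  | succ k ih => rw [pow_succ, Module.End.mul_apply, h, map_smul, ih, smul_smul, pow_succ, mul_comm]

lemma pow_eq_one_aux (T : Module.End ℂ (Fin n → ℂ)) (z v v' : Fin n → ℂ) (l l' : ℂ)
    (h : T v = l • v) (h' : T v' = l' • v') (hz : T z = z + v + v') (k : ℕ) :
    (T ^ k) z = z + (∑ q ∈ Finset.range k, l ^ q) • v + (∑ q ∈ Finset.range k, l' ^ q) • v' := by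
  induction k with
  | zero => simp
  | succ k ih =>
    rw [pow_succ, Module.End.mul_apply, hz, map_add, map_add, ih, rfn_pow_eig T v l h,
      rfn_pow_eig T v' l' h', Finset.sum_range_succ, Finset.sum_range_succ, add_smul, add_smul]
    abel

lemma rfn_order (c : Fin n → Fin n → ℂ) (a b : Fin n) (hne : a ≠ b) (q : ℂ) (m : ℕ) (hm : 2 ≤ m)
    (hq : IsPrimitiveRoot (q ^ 2) m) 
    (ha : c a a = 2) (hb : c b b = 2) (hab : c a b = -(q + q⁻¹)) (hba : c b a = -(q + q⁻¹))
    (k : ℕ) : (rfn c a * rfn c b) ^ k = 1 ↔ m ∣ k := by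
  have hq0 : q ≠ 0 := by
    rintro rfl
    have := hq.pow_eq_one
    rw [← pow_mul, zero_pow (by omega)] at this
    exact zero_ne_one this
  have e1 := rfn_eig c a b q hq0 ha hb hab hba
  have e2 := rfn_eig c a b q⁻¹ (inv_ne_zero hq0) ha hb (by rw [hab, inv_inv, add_comm])
    (by rw [hba, inv_inv, add_comm])
  constructor
  · intro h
    have := rfn_pow_eig _ _ _ e1 k
    rw [h, Module.End.one_apply] at this
    have := congrFun this b
    simp [hne] at this
    exact hq.dvd_of_pow_eq_one _ (by simpa [Pi.single_apply, hne.symm] using this.symm)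
  · intro hk
    have hd : q - q⁻¹ ≠ 0 := by
      intro h
      have h1 : q ^ 2 = 1 := by
        field_simp at h
        linear_combination h
      exact hq.ne_one (by omega) h1
    obtain ⟨k, rfl⟩ := hk
    rw [pow_mul]
    suffices h : (rfn c a * rfn c b) ^ m = 1 by rw [h, one_pow]
    apply LinearMap.ext
    intro z
    obtain ⟨A, D, hz⟩ : ∃ A D : ℂ, (rfn c a * rfn c b) z =
        z + A • Pi.single a 1 + D • Pi.single b 1 := by
      refine ⟨-(∑ x, c a x * (rfn c b z) x), -(∑ x, c b x * z x), ?_⟩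
      rw [Module.End.mul_apply, rfn_apply c a (rfn c b z)]
      nth_rewrite 1 [rfn_apply c b z]
      rw [neg_smul, neg_smul]
      abel
    set v := q • Pi.single a (1:ℂ) + Pi.single b (1:ℂ) with hv
    set v' := q⁻¹ • Pi.single a (1:ℂ) + Pi.single b (1:ℂ) with hv'
    have hz' : (rfn c a * rfn c b) z = z + ((A - D * q⁻¹) / (q - q⁻¹)) • v +
        ((D * q - A) / (q - q⁻¹)) • v' := by
      rw [hz, hv, hv']
      ext x
      simp only [Pi.add_apply, Pi.smul_apply, smul_eq_mul]
      generalize (Pi.single a 1 : Fin n → ℂ) x = X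
      generalize (Pi.single b 1 : Fin n → ℂ) x = Y
      generalize q⁻¹ = q' at *
      field_simp
      ring
    have hs1 : ∑ t ∈ Finset.range m, (q ^ 2) ^ t = 0 := hq.geom_sum_eq_zero (by omega)
    have hs2 : ∑ t ∈ Finset.range m, (q⁻¹ ^ 2) ^ t = 0 := by
      rw [inv_pow]
      exact hq.inv.geom_sum_eq_zero (by omega)
    rw [pow_eq_one_aux _ z _ _ (q ^ 2) (q⁻¹ ^ 2) ?_ ?_ hz' m, hs1, hs2]
    · simp
    · rw [map_smul, e1, smul_comm]
    · rw [map_smul, e2, smul_comm]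

/-- Gram entries. -/
noncomputable def gram (m : ℕ) : ℂ :=
  -(Complex.exp (Real.pi * Complex.I / m) + (Complex.exp (Real.pi * Complex.I / m))⁻¹)

lemma gram_one : gram 1 = 2 := by
  simp [gram, Complex.exp_pi_mul_I]; norm_num

lemma gram_prim (m : ℕ) (hm : m ≠ 0) :
    IsPrimitiveRoot ((Complex.exp (Real.pi * Complex.I / m)) ^ 2) m := by
  have := Complex.isPrimitiveRoot_exp m hm
  rw [← Complex.exp_nat_mul]
  convert this using 2
  push_cast; ring

lemma rfn_sq (c : Fin n → Fin n → ℂ) (b : Fin n) (hb : c b b = 2) : rfn c b * rfn c b = 1 := by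
  apply LinearMap.ext
  intro z
  rw [Module.End.mul_apply, rfn_apply c b z, map_sub, map_smul, rfn_single, rfn_apply, hb]
  ext x
  simp
  ring

end Geom

section Cox
variable {B : Type*} (C : CoxeterMatrix B)
open scoped Classical in
/-- affine action -/
noncomputable def aff {W : Type*} [Group W] (x : W) : Function.End (W → ZMod 2) :=
  fun A r => (if r = x then 1 else 0) + A (x * r * x)

lemma conj_iff {W : Type*} [Group W] (g r x : W) : g⁻¹ * r * g = x ↔ r = g * x * g⁻¹ := by
  constructor
  · rintro rfl; group
  · rintro rfl; group

open scoped Classical in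
lemma aff_pow {W : Type*} [Group W] (a b : W) (ha : a * a = 1) (hb : b * b = 1) (k : ℕ) (A : W → ZMod 2)
    (r : W) : ((aff a * aff b) ^ k) A r =
      (∑ q ∈ Finset.range (2 * k), if r = (a * b) ^ q * a then 1 else 0) +
        A (((a * b) ^ k)⁻¹ * r * (a * b) ^ k) := by
  have ha' : a⁻¹ = a := by rw [inv_eq_iff_mul_eq_one]; exact ha
  have hb' : b⁻¹ = b := by rw [inv_eq_iff_mul_eq_one]; exact hb
  induction k generalizing A r with
  | zero => simp; rfl
  | succ k ih =>
    rw [pow_succ]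
    change ((aff a * aff b) ^ k) ((aff a * aff b) A) r = _
    rw [ih]
    change _ + ((if _ then 1 else 0) + ((if _ then 1 else 0) + A _)) = _
    rw [show 2 * (k + 1) = 2 * k + 1 + 1 by ring, Finset.sum_range_succ, Finset.sum_range_succ]
    have comm : ∀ k : ℕ, a * ((a * b) ^ k)⁻¹ = (a * b) ^ k * a := by
      intro k
      induction k with
      | zero => simp
      | succ k ih =>
        rw [pow_succ, mul_inv_rev, mul_inv_rev, ha', hb', ← pow_succ, pow_succ']
        calc _ = a * b * (a * ((a * b) ^ k)⁻¹) := by simp [mul_assoc]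
          _ = _ := by rw [ih]; simp [mul_assoc]
    have E1 : (((a * b) ^ k)⁻¹ * r * (a * b) ^ k = a) ↔ r = (a * b) ^ (2 * k) * a := by
      have : (a * b) ^ (2 * k) * a = (a * b) ^ k * a * ((a * b) ^ k)⁻¹ := by
        rw [mul_assoc, comm, two_mul, pow_add]; simp [mul_assoc]
      rw [this, conj_iff]
    have E2 : (a * (((a * b) ^ k)⁻¹ * r * (a * b) ^ k) * a = b) ↔
        r = (a * b) ^ (2 * k + 1) * a := by
      have : (a * b) ^ (2 * k + 1) * a = (a * b) ^ k * (a * b * a) * ((a * b) ^ k)⁻¹ := by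
        rw [mul_assoc, mul_assoc (a * b) a, comm, two_mul, pow_succ', pow_add]
        simp only [← mul_assoc]
        rw [mul_assoc _ a b, ← pow_succ, ← pow_succ']
      rw [this]
      have h3 : ∀ y : W, a * y * a = b ↔ y = a * b * a := by
        intro y
        have h2 : ∀ x, a * (a * x) = x := fun x => by rw [← mul_assoc, ha, one_mul]
        constructor
        · rintro rfl; simp [mul_assoc, h2, ha]
        · rintro rfl; simp [mul_assoc, h2, ha]
      rw [h3, conj_iff]
    have E3 : b * (a * (((a * b) ^ k)⁻¹ * r * (a * b) ^ k) * a) * b =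
        ((a * b) ^ (k + 1))⁻¹ * r * (a * b) ^ (k + 1) := by
      rw [pow_succ, mul_inv_rev, mul_inv_rev, ha', hb']; simp only [mul_assoc]
    simp only [E1, E2, E3]
    ring

lemma aff_liftable {W : Type*} [Group W] (a b : W) (ha : a * a = 1) (hb : b * b = 1) (m : ℕ)
    (h : (a * b) ^ m = 1) : (aff a * aff b) ^ m = 1 := by
  classical
  funext A r
  rw [aff_pow a b ha hb, h, two_mul, Finset.sum_range_add]
  simp only [pow_add, h, one_mul]
  rw [← two_mul, show (2 : ZMod 2) = 0 from rfl]
  simp; rfl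
end Cox
end ArtinAux
namespace ArtinAux

theorem exists_cox (n : ℕ) (M : Fin n → Fin n → ℕ∞)
    (hsym : ∀ i j, M i j = M j i) (hM : ∀ i j, i ≠ j → 4 ≤ M i j) :
    ∃ (W : Type) (_ : Group W) (s : Fin n → W) (N : W → W → ZMod 2),
      (∀ b, s b * s b = 1) ∧ IsCocycle s N ∧ (∀ u, ∃ ω, pw s ω = u) ∧ Function.Injective s ∧
      ∀ a b, a ≠ b → ∀ m : ℕ, M a b = m → ∀ k, (s a * s b) ^ k = 1 ↔ m ∣ k := by
  classical
  have hM' : ∀ i j, i ≠ j → ∀ m : ℕ, M i j = m → 4 ≤ m := by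
    intro i j h m e
    have := hM i j h
    rw [e] at this
    exact_mod_cast this
  let C : CoxeterMatrix (Fin n) :=
    { M := fun a b => if a = b then 1 else (M a b).toNat
      isSymm := by
        ext a b
        change (if b = a then 1 else (M b a).toNat) = (if a = b then 1 else (M a b).toNat)
        rw [hsym a b]
        simp only [eq_comm]
      diagonal := by intro i; simp
      off_diagonal := by
        intro a b h
        simp only [h, if_false]
        intro h1
        cases e : M a b with
        | top => rw [e] at h1; simp at h1
        | coe m =>
          rw [e] at h1
          have := hM' a b h m e
          simp at h1; omega }
  have hC : ∀ a b, a ≠ b → C a b = (M a b).toNat := fun a b h => by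
    change (if a = b then 1 else (M a b).toNat) = _
    simp [h]
  let cs := C.toCoxeterSystem
  have hs : ∀ b, cs.simple b * cs.simple b = 1 := cs.simple_mul_simple_self
  let c : Fin n → Fin n → ℂ := fun a b => gram (C a b)
  have hc : ∀ a, c a a = 2 := fun a => by simp [c, gram_one]
  have hord : ∀ a b, a ≠ b → ∀ m : ℕ, M a b = m → ∀ k, (rfn c a * rfn c b) ^ k = 1 ↔ m ∣ k := by
    intro a b h m e k
    have h4 := hM' a b h m e
    have e1 : C a b = m := by rw [hC a b h, e]; simp
    have e2 : C b a = m := by rw [hC b a h.symm, hsym, e]; simp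
    exact rfn_order c a b h _ m (by omega) (gram_prim m (by omega)) (hc a) (hc b)
      (by simp only [c, e1, gram]) (by simp only [c, e2, gram]) k
  have hl : C.IsLiftable (rfn c) := by
    intro a b
    by_cases h : a = b
    · subst h; rw [rfn_sq c a (hc a), one_pow]
    · cases e : M a b with
      | top => rw [hC a b h, e]; simp
      | coe m => rw [hC a b h, e]; exact (hord a b h m e _).2 (by simp)
  let ρ := cs.lift ⟨_, hl⟩
  have hρ : ∀ b, ρ (cs.simple b) = rfn c b := fun b => cs.lift_apply_simple hl b
  have hl2 : C.IsLiftable (fun b => aff (cs.simple b)) := by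
    intro a b
    exact aff_liftable _ _ (hs a) (hs b) _ (cs.simple_mul_simple_pow a b)
  let φ := cs.lift ⟨_, hl2⟩
  have hφ : ∀ b, φ (cs.simple b) = aff (cs.simple b) := fun b => cs.lift_apply_simple hl2 b
  have hφ2 : ∀ u A r, φ u A r = φ u 0 r + A (u⁻¹ * r * u) := by
    intro u
    induction u using cs.simple_induction_left with
    | one =>
      intro A r
      rw [map_one]
      change A r = 0 + A _
      simp
    | mul_simple_left w i ih =>
      intro A r
      rw [map_mul, hφ]
      change aff _ (φ w A) r = aff _ (φ w 0) r + _
      simp only [aff]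
      rw [ih A]
      simp only [mul_inv_rev, cs.inv_simple, mul_assoc]
      ring
  refine ⟨C.Group, inferInstance, cs.simple, fun u r => φ u⁻¹ 0 r, hs, ⟨?_, ?_⟩, ?_, ?_, ?_⟩
  · intro u v r
    rw [mul_inv_rev, map_mul]
    change φ v⁻¹ (φ u⁻¹ 0) r = _
    rw [hφ2 v⁻¹]; simp
  · intro b r
    rw [cs.inv_simple, hφ]
    simp [aff]
  · intro u
    obtain ⟨ω, h⟩ := cs.wordProd_surjective u
    exact ⟨ω, h⟩
  · intro a b h
    by_contra hne
    have := congrArg ρ h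
    rw [hρ, hρ] at this
    have := congrFun (congrArg (fun T => T (Pi.single a 1)) this) a
    simp only [rfn_single, hc] at this
    simp [hne] at this
  · intro a b h m e k
    constructor
    · intro hk
      rw [← hord a b h m e, ← hρ, ← hρ, ← map_mul, ← map_pow, hk, map_one]
    · rintro ⟨q, rfl⟩
      have := cs.simple_mul_simple_pow a b
      rw [hC a b h, e] at this
      rw [pow_mul, show (cs.simple a * cs.simple b) ^ m = 1 from this, one_pow]
end ArtinAux
namespace ArtinAux
section Dihedral
variable {B W : Type*} [Group W] {s : B → W}

lemma altL_braid {A : Type*} [Group A] (g : B → A) (m : ℕ) (q : ℕ) :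
    ∀ x y : B, pw g (altL x y m) = pw g (altL y x m) →
    pw g (altL x y (m * q)) = pw g (altL y x (m * q)) := by
  have happ : ∀ (m k : ℕ) (x y : B), pw g (altL x y (m + k)) =
      pw g (altL x y m) * (if Even m then pw g (altL x y k) else pw g (altL y x k)) := by
    intro m
    induction m with
    | zero => intro k x y; simp [altL]
    | succ m ih =>
      intro k x y
      rw [show m + 1 + k = m + k + 1 by ring, altL, altL, pw_cons, pw_cons, ih, mul_assoc]
      by_cases h : Even m
      · have : ¬ Even (m + 1) := by simpa [Nat.even_add_one] using h
        simp [h, this]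
      · have : Even (m + 1) := by simpa [Nat.even_add_one] using h
        simp [h, this]
  induction q with
  | zero => intro x y _; simp [altL]
  | succ q ih =>
    intro x y h
    rw [mul_add, mul_one, add_comm, happ, happ, h, ih x y h]

lemma eq_altL (hs : ∀ b, s b * s b = 1) (x y : B) :
    ∀ ω : List B, (∀ b ∈ ω, b = x ∨ b = y) → (ris s ω).Nodup →
    ω = altL x y ω.length ∨ ω = altL y x ω.length := by
  intro ω
  induction ω with
  | nil => intro _ _; left; rfl
  | cons b ω ih =>
    intro h hn
    have hn' : (ris s ω).Nodup := by
      rw [ris, List.nodup_cons] at hn; exact hn.2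
    have ih := ih (fun c hc => h c (by simp [hc])) hn'
    cases ω with
    | nil =>
      rcases h b (by simp) with rfl | rfl
      · left; rfl
      · right; rfl
    | cons c ω =>
      have hbc : b ≠ c := by
        rintro rfl
        simp only [ris, List.nodup_cons, List.mem_cons, not_or] at hn
        apply hn.1.1
        have h1 : (s b)⁻¹ = s b := by rw [inv_eq_iff_mul_eq_one]; exact hs b
        have h2 : ∀ x, s b * (s b * x) = x := fun x => by rw [← mul_assoc, hs, one_mul]
        simp [mul_assoc, h1, h2]
      rcases h b (by simp) with rfl | rfl <;> rcases h c (by simp) with rfl | rfl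
      · exact absurd rfl hbc
      · left
        rcases ih with e | e
        · simp only [List.length_cons, altL, List.cons.injEq] at e
          exact absurd e.1.symm hbc
        · rw [List.length_cons, altL, ← e]
      · right
        rcases ih with e | e
        · rw [List.length_cons, altL, ← e]
        · simp only [List.length_cons, altL, List.cons.injEq] at e
          exact absurd e.1.symm hbc
      · exact absurd rfl hbc

lemma dihedral {N : W → W → ZMod 2} (hs : ∀ b, s b * s b = 1) (hN : IsCocycle s N)
    {A : Type*} [Group A] (g : B → A) (x y : B) (m : ℕ)
    (hm : ∀ k, (s x * s y) ^ k = 1 → m ∣ k)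
    (hg : pw g (altL x y m) = pw g (altL y x m)) (ω ω' : List B)
    (h : ∀ b ∈ ω, b = x ∨ b = y) (h' : ∀ b ∈ ω', b = x ∨ b = y)
    (hn : (ris s ω).Nodup) (hn' : (ris s ω').Nodup) (e : pw s ω = pw s ω') :
    pw g ω = pw g ω' := by
  have hlen : ω.length = ω'.length := by
    rw [← ris_length s, ← ris_length s ω']
    apply List.Perm.length_eq
    rw [List.perm_ext_iff_of_nodup hn hn']
    intro a
    rw [mem_ris_iff hN hn, mem_ris_iff hN hn', e]
  have key : ∀ k, pw s (altL x y k) = pw s (altL y x k) →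
      pw g (altL x y k) = pw g (altL y x k) := by
    intro k hk
    rw [pw_altL_eq_iff hs] at hk
    obtain ⟨q, rfl⟩ := hm k hk
    exact altL_braid g m q x y hg
  rcases eq_altL hs x y ω h hn with e1 | e1 <;> rcases eq_altL hs x y ω' h' hn' with e2 | e2 <;>
    rw [hlen] at e1 <;> clear hn hn' h h' <;> generalize ω'.length = l at e1 e2 <;>
    rw [e1, e2] at e ⊢
  · exact key _ e
  · exact (key _ e.symm).symm
end Dihedral

section Retraction
variable {B W : Type*} [Group W] {s : B → W} {N : W → W → ZMod 2}
  (hs : ∀ b, s b * s b = 1) (hN : IsCocycle s N) (hgen : ∀ u, ∃ ω, pw s ω = u)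
  (X : Set B)

/-- projection to the parabolic -/
noncomputable def prj (u : W) : W :=
  (decomp hs hN X Set.univ (u := u) (by
    obtain ⟨ω, h⟩ := hgen u; exact ⟨ω, by simp, h⟩)).choose

lemma prj_in (u : W) : In s X (prj hs hN hgen X u) :=
  (decomp hs hN X Set.univ (u := u) (by
    obtain ⟨ω, h⟩ := hgen u; exact ⟨ω, by simp, h⟩)).choose_spec.1

lemma prj_N (u : W) : ∀ r, In s X r → N (u * (prj hs hN hgen X u)⁻¹) r = 0 :=
  (decomp hs hN X Set.univ (u := u) (by
    obtain ⟨ω, h⟩ := hgen u; exact ⟨ω, by simp, h⟩)).choose_spec.2.2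

lemma prj_eq {u v : W} (hv : In s X v) (h : ∀ r, In s X r → N (u * v⁻¹) r = 0) :
    prj hs hN hgen X u = v :=
  decomp_unique hs hN (prj_in hs hN hgen X u) hv (prj_N hs hN hgen X u) h

lemma prj_self {u : W} (hu : In s X u) : prj hs hN hgen X u = u :=
  prj_eq hs hN hgen X hu (by intro r _; simp [N_one hN])

lemma prj_mem {Y : Set B} {u : W} (hu : In s Y u) : In s Y (prj hs hN hgen X u) := by
  obtain ⟨v, h1, h2, h3⟩ := decomp hs hN X Y hu
  rw [prj_eq hs hN hgen X h1 h3]; exact h2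

/-- crossed reflection, transported -/
noncomputable def tr (b : B) (u : W) : W :=
  prj hs hN hgen X u * (u⁻¹ * s b * u) * (prj hs hN hgen X u)⁻¹

lemma N_step (b : B) (u r : W) (hr : In s X r) :
    N (s b * (u * (prj hs hN hgen X u)⁻¹)) r = 1 ↔ r = tr hs hN hgen X b u := by
  rw [hN.mul, hN.gen, prj_N hs hN hgen X u r hr, zero_add]
  have : (u * (prj hs hN hgen X u)⁻¹ * r * (u * (prj hs hN hgen X u)⁻¹)⁻¹ = s b) ↔
      r = tr hs hN hgen X b u := by
    unfold tr
    constructor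
    · intro h; rw [← h]; group
    · intro h; rw [h]; group
  split_ifs with h
  · exact ⟨fun _ => this.1 h, fun _ => rfl⟩
  · exact ⟨fun h' => absurd h' (by decide), fun h' => absurd (this.2 h') h⟩

lemma zmod2_eq_zero {a : ZMod 2} (h : a ≠ 1) : a = 0 := by
  revert a; decide

lemma prj_step_in {b : B} {u : W} (h : In s X (tr hs hN hgen X b u)) :
    prj hs hN hgen X (s b * u) = tr hs hN hgen X b u * prj hs hN hgen X u := by
  apply prj_eq hs hN hgen X (h.mul (prj_in hs hN hgen X u))
  have : s b * u * (tr hs hN hgen X b u * prj hs hN hgen X u)⁻¹ =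
      u * (prj hs hN hgen X u)⁻¹ := by
    have h1 : (s b)⁻¹ = s b := by rw [inv_eq_iff_mul_eq_one]; exact hs b
    have h2 : ∀ x, s b * (s b * x) = x := fun x => by rw [← mul_assoc, hs, one_mul]
    simp [tr, mul_assoc, h1, h2]
  rw [this]
  exact prj_N hs hN hgen X u

lemma prj_step_out {b : B} {u : W} (h : ¬ In s X (tr hs hN hgen X b u)) :
    prj hs hN hgen X (s b * u) = prj hs hN hgen X u := by
  apply prj_eq hs hN hgen X (prj_in hs hN hgen X u)
  intro r hr
  rw [mul_assoc]
  apply zmod2_eq_zero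
  rw [Ne, N_step hs hN hgen X b u r hr]
  rintro rfl
  exact h hr

lemma tr_simple {b : B} {u : W} (h : In s X (tr hs hN hgen X b u)) :
    ∃ x ∈ X, tr hs hN hgen X b u = s x := by
  apply simple_of_N hs hN h
  intro r
  by_cases hr : In s X r
  · rw [← N_step hs hN hgen X b u r hr]
    have : s b * (u * (prj hs hN hgen X u)⁻¹) =
        (u * (prj hs hN hgen X u)⁻¹) * tr hs hN hgen X b u := by
      unfold tr; group
    rw [this, hN.mul _ _ r, prj_N hs hN hgen X u _ ((h.mul hr).mul (h.inv hs)), add_zero]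
  · rw [N_out hs hN h hr]
    constructor
    · intro h; exact absurd h (by decide)
    · rintro rfl; exact absurd h hr

open scoped Classical in
/-- output letters -/
noncomputable def out (b : B) (u : W) : List B :=
  if h : In s X (tr hs hN hgen X b u) then [(tr_simple hs hN hgen X h).choose] else []

lemma out_cases (b : B) (u : W) :
    (∃ x ∈ X, tr hs hN hgen X b u = s x ∧ out hs hN hgen X b u = [x] ∧
      prj hs hN hgen X (s b * u) = s x * prj hs hN hgen X u) ∨
    (¬ In s X (tr hs hN hgen X b u) ∧ out hs hN hgen X b u = [] ∧
      prj hs hN hgen X (s b * u) = prj hs hN hgen X u) := by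
  by_cases h : In s X (tr hs hN hgen X b u)
  · left
    have hc := (tr_simple hs hN hgen X h).choose_spec
    refine ⟨_, hc.1, hc.2, ?_, ?_⟩
    · rw [out, dif_pos h]
    · rw [← hc.2]; exact prj_step_in hs hN hgen X h
  · right
    exact ⟨h, by rw [out, dif_neg h], prj_step_out hs hN hgen X h⟩

/-- output word -/
noncomputable def Out : List B → W → List B
  | [], _ => []
  | b :: ω, u => out hs hN hgen X b (pw s ω * u) ++ Out ω u

lemma Out_mem (ω : List B) (u : W) : ∀ b ∈ Out hs hN hgen X ω u, b ∈ X := by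
  induction ω with
  | nil => simp [Out]
  | cons b ω ih =>
    intro c hc
    rw [Out, List.mem_append] at hc
    rcases hc with hc | hc
    · rcases out_cases hs hN hgen X b (pw s ω * u) with ⟨x, hx, -, h, -⟩ | ⟨-, h, -⟩
      · rw [h] at hc; simp at hc; rwa [hc]
      · rw [h] at hc; simp at hc
    · exact ih c hc

lemma pw_Out (ω : List B) (u : W) :
    pw s (Out hs hN hgen X ω u) = prj hs hN hgen X (pw s ω * u) * (prj hs hN hgen X u)⁻¹ := by
  induction ω with
  | nil => simp [Out]
  | cons b ω ih =>
    rw [Out, pw_append, ih, pw_cons, mul_assoc (s b)]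
    rcases out_cases hs hN hgen X b (pw s ω * u) with ⟨x, hx, -, h, h'⟩ | ⟨-, h, h'⟩
    · rw [h, h']; simp [mul_assoc]
    · rw [h, h']; simp

lemma ris_Out (ω : List B) (u : W) :
    (ris s (Out hs hN hgen X ω u)).Sublist ((ris s ω).map
      (fun r => (prj hs hN hgen X u * u⁻¹) * r * (prj hs hN hgen X u * u⁻¹)⁻¹)) := by
  induction ω with
  | nil => simp [Out, ris]
  | cons b ω ih =>
    rw [Out]
    rcases out_cases hs hN hgen X b (pw s ω * u) with ⟨x, hx, h1, h, h'⟩ | ⟨-, h, h'⟩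
    · rw [h, List.singleton_append, ris, ris, List.map_cons]
      have : (pw s (Out hs hN hgen X ω u))⁻¹ * s x * pw s (Out hs hN hgen X ω u) =
          (prj hs hN hgen X u * u⁻¹) * ((pw s ω)⁻¹ * s b * pw s ω) *
            (prj hs hN hgen X u * u⁻¹)⁻¹ := by
        rw [pw_Out, ← h1, tr]; group
      rw [this]
      exact ih.cons_cons _
    · rw [h, List.nil_append, ris, List.map_cons]
      exact ih.cons _

lemma ris_Out_nodup (ω : List B) (u : W) (h : (ris s ω).Nodup) :
    (ris s (Out hs hN hgen X ω u)).Nodup := by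
  refine (ris_Out hs hN hgen X ω u).nodup (h.map ?_)
  intro a b hab
  simpa using hab

/-- The permutation attached to a generator. -/
noncomputable def perm {A : Type*} [Group A] (g : B → A) (b : B) : Equiv.Perm (A × W) where
  toFun p := (pw g (out hs hN hgen X b p.2) * p.1, s b * p.2)
  invFun p := ((pw g (out hs hN hgen X b (s b * p.2)))⁻¹ * p.1, s b * p.2)
  left_inv p := by
    have h2 : ∀ x, s b * (s b * x) = x := fun x => by rw [← mul_assoc, hs, one_mul]
    simp [h2]
  right_inv p := by
    have h2 : ∀ x, s b * (s b * x) = x := fun x => by rw [← mul_assoc, hs, one_mul]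
    simp [h2]

lemma perm_word {A : Type*} [Group A] (g : B → A) (ω : List B) (h : A) (u : W) :
    pw (perm hs hN hgen X g) ω (h, u) = (pw g (Out hs hN hgen X ω u) * h, pw s ω * u) := by
  induction ω with
  | nil => simp [Out]
  | cons b ω ih =>
    rw [pw_cons, Equiv.Perm.mul_apply, ih, Out, pw_append, pw_cons]
    simp [perm, mul_assoc]

end Retraction

lemma lift_altWord {σ A : Type*} [Group A] (f : σ → A) (x y : σ) (m : ℕ) :
    FreeGroup.lift f (altWord x y m) = pw f (altL x y m) := by
  induction m generalizing x y with
  | zero => simp [altWord, altL]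
  | succ m ih => simp [altWord, altL, ih]

end ArtinAux

open ArtinAux

theorem artin_parabolic_inter_eq_cyclic (n : ℕ) (M : Fin n → Fin n → ℕ∞)
    (hsym : ∀ i j, M i j = M j i) (hM : ∀ i j, i ≠ j → 4 ≤ M i j)
    (i j k : Fin n) (hij : i ≠ j) (hik : i ≠ k) (hjk : j ≠ k)
    (hfinij : M i j ≠ ⊤) (hfinik : M i k ≠ ⊤) :
    Subgroup.closure {artinMk n M (FreeGroup.of i), artinMk n M (FreeGroup.of j)} ⊓
      Subgroup.closure {artinMk n M (FreeGroup.of i), artinMk n M (FreeGroup.of k)} =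
    Subgroup.closure {artinMk n M (FreeGroup.of i)} := by
  obtain ⟨W, _, s, N, hs, hN, hgen, hinj, hord⟩ := exists_cox n M hsym hM
  obtain ⟨m, hm⟩ := ENat.ne_top_iff_exists.1 hfinij
  let g : Fin n → PresentedGroup (artinRels n M) := fun b => artinMk n M (FreeGroup.of b)
  have hmk : ∀ w, artinMk n M w = FreeGroup.lift g w := by
    intro w
    have : artinMk n M = FreeGroup.lift g := by
      ext b; simp [g]
    rw [this]
  have hg : ∀ a b, a ≠ b → ∀ m : ℕ, M a b = m → pw g (altL a b m) = pw g (altL b a m) := by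
    intro a b hab m hm
    rw [← lift_altWord, ← lift_altWord, ← hmk, ← hmk, ← mul_inv_eq_one, ← map_inv, ← map_mul]
    exact PresentedGroup.one_of_mem ⟨a, b, hab, m, hm, rfl⟩
  let X : Set (Fin n) := {i, j}
  let Y : Set (Fin n) := {i, k}
  let P := perm hs hN hgen X g
  have hP : ∀ r ∈ artinRels n M, FreeGroup.lift P r = 1 := by
    rintro r ⟨a, b, hab, m', hm', rfl⟩
    rw [map_mul, map_inv, mul_inv_eq_one, lift_altWord, lift_altWord]
    ext1 ⟨h, u⟩
    have hba : M b a = m' := by rw [hsym, hm']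
    have e : pw s (altL a b m') = pw s (altL b a m') := by
      rw [pw_altL_eq_iff hs]; exact (hord a b hab m' hm' _).2 (dvd_refl _)
    rw [perm_word, perm_word, e]
    congr 2
    apply dihedral hs hN g i j m (fun k => (hord i j hij m hm.symm k).1) (hg i j hij m hm.symm)
    · exact Out_mem hs hN hgen X _ u
    · exact Out_mem hs hN hgen X _ u
    · exact ris_Out_nodup hs hN hgen X _ u
        (ris_altL_nodup hs a b m' (fun k => (hord a b hab m' hm' k).1))
    · exact ris_Out_nodup hs hN hgen X _ u
        (ris_altL_nodup hs b a m' (fun k => (hord b a hab.symm m' hba k).1))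
    · rw [pw_Out, pw_Out, e]
  let Φ : PresentedGroup (artinRels n M) →* Equiv.Perm (PresentedGroup (artinRels n M) × W) :=
    PresentedGroup.toGroup hP
  have hΦ : ∀ b h u, Φ (g b) (h, u) = (pw g (out hs hN hgen X b u) * h, s b * u) := by
    intro b h u
    have : Φ (g b) = P b := PresentedGroup.toGroup.of hP
    rw [this]; rfl
  have hXc : ∀ x ∈ Subgroup.closure {g i, g j}, ∃ w, In s X w ∧
      ∀ h u, In s X u → Φ x (h, u) = (x * h, w * u) := by
    intro x hx
    induction hx using Subgroup.closure_induction with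
    | mem x hx =>
      obtain ⟨b, hb, rfl⟩ : ∃ b ∈ X, x = g b := by
        rcases hx with rfl | rfl
        · exact ⟨i, by simp [X], rfl⟩
        · exact ⟨j, by simp [X], rfl⟩
      refine ⟨s b, In.gen hb, fun h u hu => ?_⟩
      rw [hΦ]
      have ht : tr hs hN hgen X b u = s b := by
        rw [tr, prj_self hs hN hgen X hu]; group
      rcases out_cases hs hN hgen X b u with ⟨x, hx, h1, h2, -⟩ | ⟨h1, -⟩
      · rw [ht] at h1
        rw [h2, ← hinj h1]; simp
      · rw [ht] at h1
        exact absurd (In.gen hb) h1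
    | one => exact ⟨1, In.one _, by simp⟩
    | mul x y _ _ hx hy =>
      obtain ⟨w, h1, h2⟩ := hx
      obtain ⟨w', h1', h2'⟩ := hy
      refine ⟨w * w', h1.mul h1', fun h u hu => ?_⟩
      rw [map_mul, Equiv.Perm.mul_apply, h2' h u hu, h2 _ _ (h1'.mul hu)]
      simp [mul_assoc]
    | inv x _ hx =>
      obtain ⟨w, h1, h2⟩ := hx
      refine ⟨w⁻¹, h1.inv hs, fun h u hu => ?_⟩
      rw [map_inv, Equiv.Perm.inv_eq_iff_eq, h2 _ _ ((h1.inv hs).mul hu)]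
      simp
  have hYc : ∀ x ∈ Subgroup.closure {g i, g k}, ∃ w, In s Y w ∧
      ∀ u, In s Y u → ∃ c ∈ Subgroup.closure {g i}, ∀ h, Φ x (h, u) = (c * h, w * u) := by
    intro x hx
    induction hx using Subgroup.closure_induction with
    | mem x hx =>
      obtain ⟨b, hb, rfl⟩ : ∃ b ∈ Y, x = g b := by
        rcases hx with rfl | rfl
        · exact ⟨i, by simp [Y], rfl⟩
        · exact ⟨k, by simp [Y], rfl⟩
      refine ⟨s b, In.gen hb, fun u hu => ?_⟩
      refine ⟨pw g (out hs hN hgen X b u), ?_, fun h => hΦ b h u⟩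
      rcases out_cases hs hN hgen X b u with ⟨x, hx, h1, h2, -⟩ | ⟨-, h2, -⟩
      · have hp := prj_mem hs hN hgen X hu
        have ht : In s Y (s x) := by
          rw [← h1, tr]
          exact (hp.mul (((hu.inv hs).mul (In.gen hb)).mul hu)).mul (hp.inv hs)
        obtain ⟨y, hy, e⟩ := simple_of_N hs hN ht (by
          intro r; rw [hN.gen]
          split_ifs with h
          · simp [h]
          · simp [h])
        have := hinj e
        subst this
        have : x = i := by
          rcases hx with h | h
          · exact h
          · rcases hy with h' | h'
            · exact h'
            · exact absurd (h.symm.trans h') hjk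
        rw [h2, this]
        simpa using Subgroup.subset_closure (Set.mem_singleton (g i))
      · rw [h2]; simp [Subgroup.one_mem]
    | one => exact ⟨1, In.one _, fun u _ => ⟨1, Subgroup.one_mem _, by simp⟩⟩
    | mul x y _ _ hx hy =>
      obtain ⟨w, h1, h2⟩ := hx
      obtain ⟨w', h1', h2'⟩ := hy
      refine ⟨w * w', h1.mul h1', fun u hu => ?_⟩
      obtain ⟨c', hc', e'⟩ := h2' u hu
      obtain ⟨c, hc, e⟩ := h2 _ (h1'.mul hu)
      refine ⟨c * c', Subgroup.mul_mem _ hc hc', fun h => ?_⟩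
      rw [map_mul, Equiv.Perm.mul_apply, e', e]
      simp [mul_assoc]
    | inv x _ hx =>
      obtain ⟨w, h1, h2⟩ := hx
      refine ⟨w⁻¹, h1.inv hs, fun u hu => ?_⟩
      obtain ⟨c, hc, e⟩ := h2 _ ((h1.inv hs).mul hu)
      refine ⟨c⁻¹, Subgroup.inv_mem _ hc, fun h => ?_⟩
      rw [map_inv, Equiv.Perm.inv_eq_iff_eq, e]
      simp
  apply le_antisymm
  · rintro x ⟨h1, h2⟩
    obtain ⟨w, -, e⟩ := hXc x h1
    obtain ⟨w', -, e'⟩ := hYc x h2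
    obtain ⟨c, hc, e'⟩ := e' 1 (In.one _)
    have := e 1 1 (In.one _)
    rw [e' 1] at this
    have := congrArg Prod.fst this
    simp only [mul_one] at this
    rw [← this]
    exact hc
  · refine le_inf ?_ ?_ <;> apply Subgroup.closure_mono <;> simp
end
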